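/- Let L be a finite-dimensional Lie algebra over a field F such that d(L) = dim_F L, and suppose L is not abelian. Then the derived subalgebra [L,L] is abelian, i.e. L is metabelian. -/

import Mathlib

/-- The minimal number of generators of a Lie algebra `L` over `R`. -/
noncomputable def lieD (R L : Type*) [CommRing R] [LieRing L] [LieAlgebra R L] : ℕ :=
  sInf {n | ∃ s : Finset L, s.card = n ∧ LieSubalgebra.lieSpan R L ↑s = ⊤}

theorem lieD_lt_finrank_of_linearIndependent {F L : Type*} [Field F] [LieRing L] [LieAlgebra F L]
    [FiniteDimensional F L] {x y : L} (h : LinearIndependent F ![x, y, ⁅x, y⁆]) :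
    lieD F L < Module.finrank F L := by
  classical
  have hs := h.linearIndepOn_id
  let b := Module.Basis.extend hs
  let t : Finset L := Finset.univ.image b
  have ht : t.card = Module.finrank F L := by
    rw [Finset.card_image_of_injective _ b.injective, Finset.card_univ,
      Module.finrank_eq_card_basis b]
  have mem_t (i : Fin 3) : ![x, y, ⁅x, y⁆] i ∈ t := by
    have hi := Module.Basis.subset_extend hs (Set.mem_range_self i)
    exact Finset.mem_image.2 ⟨⟨_, hi⟩, Finset.mem_univ _, Module.Basis.extend_apply_self hs _⟩
  have hx : x ∈ t.erase ⁅x, y⁆ :=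
    Finset.mem_erase.2 ⟨fun e ↦ absurd (h.injective (a₁ := 0) (a₂ := 2) e) (by decide), mem_t 0⟩
  have hy : y ∈ t.erase ⁅x, y⁆ :=
    Finset.mem_erase.2 ⟨fun e ↦ absurd (h.injective (a₁ := 1) (a₂ := 2) e) (by decide), mem_t 1⟩
  have hspan : LieSubalgebra.lieSpan F L (t.erase ⁅x, y⁆ : Set L) = ⊤ := by
    have sub := LieSubalgebra.subset_lieSpan (R := F) (s := (t.erase ⁅x, y⁆ : Set L))
    rw [← LieSubalgebra.toSubmodule_inj, LieSubalgebra.top_toSubmodule, eq_top_iff, ← b.span_eq,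
      Submodule.span_le]
    rintro _ ⟨i, rfl⟩
    by_cases hi : b i = ⁅x, y⁆
    · rw [hi]
      exact LieSubalgebra.lie_mem _ (sub hx) (sub hy)
    · exact sub (Finset.mem_erase.2 ⟨hi, Finset.mem_image_of_mem _ (Finset.mem_univ i)⟩)
  calc lieD F L ≤ (t.erase ⁅x, y⁆).card := Nat.sInf_le ⟨_, rfl, hspan⟩
    _ < t.card := Finset.card_erase_lt_of_mem (mem_t 2)
    _ = Module.finrank F L := ht

section

variable {F L : Type*} [Field F] [LieRing L] [LieAlgebra F L]

theorem exists_lie_eq_smul_add_smul (h : ∀ x y : L, ¬ LinearIndependent F ![x, y, ⁅x, y⁆])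
    {x : L} (hx : x ≠ 0) : ∃ a : F, ∀ y : L, ∃ c : F, ⁅x, y⁆ = a • y + c • x := by
  let S := Submodule.span F {x}
  have hS : S ≤ S.comap (LieAlgebra.ad F L x) := by
    simp [S, Submodule.span_le]
  obtain ⟨a, ha⟩ := LinearMap.exists_eq_smul_id_of_forall_notLinearIndependent
    (f := S.mapQ S (LieAlgebra.ad F L x) hS) fun v hv ↦ by
      obtain ⟨y, rfl⟩ := S.mkQ_surjective v
      apply h x y
      rw [LinearIndependent.pair_iff] at hv
      rw [Fintype.linearIndependent_iff]
      intro g hg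
      simp only [Fin.sum_univ_three, Matrix.cons_val] at hg
      have hgS : g 1 • y + g 2 • ⁅x, y⁆ ∈ S := by
        rw [Submodule.mem_span_singleton]
        refine ⟨-g 0, ?_⟩
        rw [neg_smul, neg_eq_iff_add_eq_zero, ← add_assoc, hg]
      obtain ⟨h1, h2⟩ := hv (g 1) (g 2) (by
        simpa using (Submodule.Quotient.mk_eq_zero S).2 hgS)
      have h0 : g 0 = 0 := by simpa [h1, h2, hx] using hg
      intro i
      fin_cases i <;> assumption
  refine ⟨a, fun y ↦ ?_⟩
  have hy := LinearMap.congr_fun ha (S.mkQ y)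
  have hmem : ⁅x, y⁆ - a • y ∈ S := by
    rw [← Submodule.Quotient.mk_eq_zero, Submodule.Quotient.mk_sub, sub_eq_zero]
    simpa using hy
  obtain ⟨c, hc⟩ := Submodule.mem_span_singleton.1 hmem
  exact ⟨c, by rw [hc]; abel⟩

theorem exists_forall_lie_eq_smul_sub_smul
    (h : ∀ x y : L, ¬ LinearIndependent F ![x, y, ⁅x, y⁆]) (hna : ¬ IsLieAbelian L) :
    ∃ f : L →ₗ[F] F, ∀ x y : L, ⁅x, y⁆ = f x • y - f y • x := by
  have key (x : L) : ∃ a : F, (x = 0 → a = 0) ∧ ∀ y : L, ∃ c : F, ⁅x, y⁆ = a • y + c • x := by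
    by_cases hx : x = 0
    · exact ⟨0, fun _ ↦ rfl, fun y ↦ ⟨0, by simp [hx]⟩⟩
    · obtain ⟨a, ha⟩ := exists_lie_eq_smul_add_smul h hx
      exact ⟨a, fun e ↦ absurd e hx, ha⟩
  choose f f_zero hf using key
  have lie_eq {x y : L} (hxy : LinearIndependent F ![x, y]) : ⁅x, y⁆ = f x • y - f y • x := by
    obtain ⟨c, hc⟩ := hf x y
    obtain ⟨d, hd⟩ := hf y x
    have e : (c + f y) • x + (f x + d) • y = 0 := by
      rw [← add_neg_cancel ⁅x, y⁆, lie_skew]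
      rw [hc, hd]
      module
    have := (LinearIndependent.pair_iff.1 hxy _ _ e).1
    rw [hc, eq_neg_of_add_eq_zero_left this]
    module
  have exists_indep {x : L} (hx : x ≠ 0) : ∃ z, LinearIndependent F ![x, z] := by
    by_contra! hz
    simp only [LinearIndependent.pair_iff' hx, not_forall, not_not] at hz
    refine hna ⟨fun u v ↦ ?_⟩
    obtain ⟨a, rfl⟩ := hz u
    obtain ⟨b, rfl⟩ := hz v
    simp
  have f_smul (c : F) (x : L) : f (c • x) = c * f x := by
    by_cases hc : c = 0
    · rw [hc, zero_smul, f_zero 0 rfl, zero_mul]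
    by_cases hx : x = 0
    · rw [hx, smul_zero, f_zero 0 rfl, mul_zero]
    obtain ⟨z, hz⟩ := exists_indep hx
    have hz' : LinearIndependent F ![c • x, z] := by
      rw [LinearIndependent.pair_iff] at hz ⊢
      intro s t e
      rw [smul_smul] at e
      simpa [hc] using hz _ _ e
    have e := lie_eq hz'
    rw [smul_lie, lie_eq hz] at e
    have e' : 0 • x + (f (c • x) - c * f x) • z = 0 := by
      linear_combination (norm := module) -e
    exact sub_eq_zero.1 (LinearIndependent.pair_iff.1 hz 0 _ (by simpa using e')).2
  have f_add (x y : L) : f (x + y) = f x + f y := by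
    by_cases hxy : LinearIndependent F ![x, y]
    · have e := lie_eq (LinearIndependent.pair_add_right_iff.2 hxy)
      rw [lie_add, lie_self, zero_add, lie_eq hxy] at e
      have e' : (f (x + y) - f x - f y) • x + (0 : F) • y = 0 := by
        linear_combination (norm := module) e
      linear_combination (LinearIndependent.pair_iff.1 hxy _ _ e').1
    · by_cases hx : x = 0
      · rw [hx, f_zero 0 rfl, zero_add, zero_add]
      · simp only [LinearIndependent.pair_iff' hx, not_forall, not_not] at hxy
        obtain ⟨a, rfl⟩ := hxy
        rw [show x + a • x = (1 + a) • x by module, f_smul, f_smul]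
        ring
  refine ⟨⟨⟨f, f_add⟩, f_smul⟩, fun x y ↦ ?_⟩
  change ⁅x, y⁆ = f x • y - f y • x
  by_cases hxy : LinearIndependent F ![x, y]
  · exact lie_eq hxy
  · by_cases hx : x = 0
    · simp [hx, f_zero 0 rfl]
    · simp only [LinearIndependent.pair_iff' hx, not_forall, not_not] at hxy
      obtain ⟨a, rfl⟩ := hxy
      rw [lie_smul, lie_self, f_smul]
      module

theorem isLieAbelian_derived_of_forall_lie_eq {f : L →ₗ[F] F}
    (hf : ∀ x y : L, ⁅x, y⁆ = f x • y - f y • x) :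
    IsLieAbelian (⁅(⊤ : LieIdeal F L), (⊤ : LieIdeal F L)⁆ : LieIdeal F L) := by
  have hker {x : L} (hx : x ∈ (⁅(⊤ : LieIdeal F L), (⊤ : LieIdeal F L)⁆ : LieIdeal F L)) :
      f x = 0 := by
    rw [← LieSubmodule.mem_toSubmodule, LieSubmodule.lieIdeal_oper_eq_linear_span'] at hx
    refine (Submodule.span_le (p := LinearMap.ker f)).2 ?_ hx
    rintro _ ⟨u, -, v, -, rfl⟩
    simp [hf, mul_comm]
  refine ⟨fun x y ↦ Subtype.ext ?_⟩
  change ⁅(x : L), (y : L)⁆ = 0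
  rw [hf, hker x.2, hker y.2, zero_smul, zero_smul, sub_zero]

end

/-- If `L` is a finite-dimensional Lie algebra over a field `F` with `d(L) = dim_F L` and
`L` is not abelian, then the derived subalgebra `[L,L]` is abelian, i.e. `L` is metabelian. -/
theorem stmt_1 (F L : Type*) [Field F] [LieRing L] [LieAlgebra F L]
    [FiniteDimensional F L] (h : lieD F L = Module.finrank F L)
    (hna : ¬ IsLieAbelian L) :
    IsLieAbelian (⁅(⊤ : LieIdeal F L), (⊤ : LieIdeal F L)⁆ : LieIdeal F L) := by
  obtain ⟨f, hf⟩ := exists_forall_lie_eq_smul_sub_smul (F := F)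
    (fun x y hxy ↦ (lieD_lt_finrank_of_linearIndependent hxy).ne h) hna
  exact isLieAbelian_derived_of_forall_lie_eq hf
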